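/- arXiv:1312.4095 — 4 statements merged into one kernel-verified Lean document; each statement's English description precedes it below -/
import Mathlib

section
/- The family ℬ is closed under restriction: for every α < ω₁, every ideal I ∈ ℬ_α, and every infinite set K ⊆ ℕ, the restriction I↾K is (isomorphic to) an ideal in ℬ_α. -/
open Set

/-- The orthogonal of a family of sets: all sets having finite intersection
with every member of the family. -/
def orth {X : Type*} (I : Set (Set X)) : Set (Set X) :=
  {B | ∀ A ∈ I, (A ∩ B).Finite}

/-- `I` is an ideal on `X`: contains `∅`, closed under subsets and finite unions
(the improper ideal `𝒫 X` is allowed). -/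
def IsIdealOn {X : Type*} (I : Set (Set X)) : Prop :=
  ∅ ∈ I ∧ (∀ A ∈ I, ∀ B ⊆ A, B ∈ I) ∧ (∀ A ∈ I, ∀ B ∈ I, A ∪ B ∈ I)

/-- An ideal is Fréchet if it equals its double orthogonal. -/
def IsFrechet {X : Type*} (I : Set (Set X)) : Prop := orth (orth I) = I

/-- Isomorphism of ideals: a bijection of the underlying sets such that
`A ∈ I ↔ f '' A ∈ J`. -/
def IdealIso {X Y : Type*} (I : Set (Set X)) (J : Set (Set Y)) : Prop :=
  ∃ f : X ≃ Y, ∀ A : Set X, A ∈ I ↔ f '' A ∈ J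

/-- Isomorphic embedding of ideals: an injection of the underlying sets such that
`A ∈ I ↔ f '' A ∈ J`. -/
def IdealEmbeds {X Y : Type*} (I : Set (Set X)) (J : Set (Set Y)) : Prop :=
  ∃ f : X → Y, Function.Injective f ∧ ∀ A : Set X, A ∈ I ↔ f '' A ∈ J

/-- The restriction `I ↾ K` of an ideal on `X` to a subset `K ⊆ X`,
viewed as an ideal on the subtype `↥K`. -/
def restrictIdeal {X : Type*} (I : Set (Set X)) (K : Set X) : Set (Set ↥K) :=
  {A | (Subtype.val '' A : Set X) ∈ I}

/-- `FIN`, the ideal of finite subsets of `ℕ`. -/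
def finIdeal : Set (Set ℕ) := {A | A.Finite}

/-- Countable direct sum of ideals on `ℕ`, realized on `ℕ` via the pairing
bijection `ℕ × ℕ ≃ ℕ`: the `n`-th block is `{Nat.pair n m : m ∈ ℕ}`. -/
def directSumN (I : ℕ → Set (Set ℕ)) : Set (Set ℕ) :=
  {A | ∀ n, {m | Nat.pair n m ∈ A} ∈ I n}

/-- Finite direct sum `I 0 ⊕ ⋯ ⊕ I k` of ideals on `ℕ`, realized on `ℕ` using
the partition of `ℕ` into residue classes mod `k + 1`. -/
def finSumN (k : ℕ) (I : ℕ → Set (Set ℕ)) : Set (Set ℕ) :=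
  {A | ∀ i ≤ k, {m | m * (k + 1) + i ∈ A} ∈ I i}

/-- Binary direct sum of ideals on `ℕ`, realized on `ℕ` via evens and odds. -/
def sum2 (I J : Set (Set ℕ)) : Set (Set ℕ) :=
  {A | {m | 2 * m ∈ A} ∈ I ∧ {m | 2 * m + 1 ∈ A} ∈ J}

/-- All countable direct sums of members of `U`. -/
def sumsOf (U : Set (Set (Set ℕ))) : Set (Set (Set ℕ)) :=
  {J | ∃ I : ℕ → Set (Set ℕ), (∀ n, I n ∈ U) ∧ J = directSumN I}

/-- `ℬ_α^{⊕⊥}`: countable direct sums of members of `U` together with their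
orthogonals. -/
def sumsPerpOf (U : Set (Set (Set ℕ))) : Set (Set (Set ℕ)) :=
  sumsOf U ∪ {J | ∃ I ∈ sumsOf U, J = orth I}

/-- `ℬ_α`: finite direct sums of members of `ℬ_α^{⊕⊥}`. -/
def BstepOf (U : Set (Set (Set ℕ))) : Set (Set (Set ℕ)) :=
  {J | ∃ k, ∃ I : ℕ → Set (Set ℕ), (∀ i ≤ k, I i ∈ sumsPerpOf U) ∧ J = finSumN k I}

/-- The hierarchy `ℬ_α`: `ℬ₀ = {𝒫(ℕ), FIN, 𝒫(ℕ) ⊕ FIN}` and, for `α > 0`,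
`ℬ_α` consists of the finite direct sums of countable direct sums of members of
`⋃_{ξ<α} ℬ_ξ` and of orthogonals of such countable sums. -/
noncomputable def Bfam : Ordinal.{0} → Set (Set (Set ℕ)) :=
  WellFounded.fix wellFounded_lt fun α ih =>
    if α = 0 then {(Set.univ : Set (Set ℕ)), finIdeal, sum2 Set.univ finIdeal}
    else BstepOf {I | ∃ ξ, ∃ h : ξ < α, I ∈ ih ξ h}

/-- The first uncountable ordinal `ω₁`. -/
noncomputable def omega1 : Ordinal.{0} := (Cardinal.aleph 1).ord

/-- An ideal (on any countable set) belongs to `ℬ = ⋃_{α<ω₁} ℬ_α`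
(membership in `ℬ` is understood up to isomorphism). -/
def InB {X : Type*} (I : Set (Set X)) : Prop :=
  ∃ α, α < omega1 ∧ ∃ J ∈ Bfam α, IdealIso I J

/-- The ideals `P_α`: `P₀ = 𝒫(ℕ)`, `P_{α+1} = (P_α⊥)^ω`, and for limit `α`,
`P_α = ⊕ₙ P_{v α n}⊥` where `v α` is a fixed increasing sequence with supremum `α`. -/
noncomputable def Pfam (v : Ordinal.{0} → ℕ → Ordinal.{0}) : Ordinal.{0} → Set (Set ℕ) :=
  fun α => @Ordinal.limitRecOn (fun _ => Set (Set ℕ)) α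
    (Set.univ : Set (Set ℕ))
    (fun _ P => directSumN fun _ => orth P)
    (fun β _ ih => directSumN fun n =>
      if h : v β n < β then orth (ih (v β n) h) else ∅)

/-- The subset of the Cantor cube `2^X` corresponding to a family of subsets of `X`. -/
def idealSet {X : Type*} (I : Set (Set X)) : Set (X → Bool) := {f | {x | f x = true} ∈ I}

/-- An ideal is Borel if the corresponding subset of the Cantor cube `2^X` is Borel. -/
def IsBorelIdeal {X : Type*} (I : Set (Set X)) : Prop := MeasurableSet (idealSet I)

/-- A subset of the Cantor cube is `F_σδ` if it is a countable intersection of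
countable unions of closed sets. -/
def IsFsd {X : Type*} (S : Set (X → Bool)) : Prop :=
  ∃ C : ℕ → ℕ → Set (X → Bool), (∀ n m, IsClosed (C n m)) ∧ S = ⋂ n, ⋃ m, C n m

/-- The tree `⟨A⟩` generated by `A ⊆ ℕ^{<ω}`: all prefixes of members of `A`. -/
def genTree (A : Set (List ℕ)) : Set (List ℕ) := {t | ∃ a ∈ A, t <+: a}

/-- The ideal `I_wf` on `ℕ^{<ω}` of well founded sets: those `A` such that no
`α ∈ ℕ^ω` has all of its finite initial segments in `⟨A⟩`. -/
def Iwf : Set (Set (List ℕ)) :=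
  {A | ¬ ∃ α : ℕ → ℕ, ∀ n, (List.ofFn fun i : Fin n => α i) ∈ genTree A}

/-- The ideal `I_d = I_wf⊥` on `ℕ^{<ω}` of sets dominated by a branch. -/
def Idom : Set (Set (List ℕ)) :=
  {A | ∃ α : ℕ → ℕ, ∀ s ∈ A, ∀ i : Fin s.length, s.get i ≤ α i.1}

/-- `𝒩_t`, the set of extensions of `t` in `ℕ^{<ω}`. -/
def Nbhd (t : List ℕ) : Set (List ℕ) := {s | t <+: s}

/-- Direct sum of a sequence of ideals `I n` on sets `X n`, as an ideal on the
disjoint union `Σ n, X n` (the partition into the fibers). -/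
def sigmaSum {X : ℕ → Type*} (I : ∀ n, Set (Set (X n))) : Set (Set (Σ n, X n)) :=
  {A | ∀ n, {x | (⟨n, x⟩ : Σ n, X n) ∈ A} ∈ I n}

/-- Binary direct sum of ideals on `X` and `Y`, as an ideal on `X ⊕ Y`. -/
def sumIdeal2 {X Y : Type*} (I : Set (Set X)) (J : Set (Set Y)) : Set (Set (X ⊕ Y)) :=
  {A | (Sum.inl ⁻¹' A) ∈ I ∧ (Sum.inr ⁻¹' A) ∈ J}

/-- A tree on `ℕ`: a subset of `ℕ^{<ω}` downward closed under the prefix order. -/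
def IsTree (T : Set (List ℕ)) : Prop := ∀ s ∈ T, ∀ t, t <+: s → t ∈ T

/-- `A_a = {s ∈ A : a ≼ s}`. -/
def subAt (A : Set (List ℕ)) (a : List ℕ) : Set (List ℕ) := {s ∈ A | a <+: s}

/-- The derivative `A' = {a ∈ A : A_a ∉ I_d}`. -/
def derivD (A : Set (List ℕ)) : Set (List ℕ) := {a ∈ A | subAt A a ∉ Idom}

/-- The iterated derivative `A^{(α)}`. -/
noncomputable def derivIter (A : Set (List ℕ)) : Ordinal.{0} → Set (List ℕ) :=
  fun α => @Ordinal.limitRecOn (fun _ => Set (List ℕ)) α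
    A (fun _ S => derivD S) (fun β _ ih => ⋂ ξ, ⋂ h : ξ < β, ih ξ h)

/-- The rank of `A`: the least `α` with `A^{(α)} = A^{(α+1)}`. -/
noncomputable def rkD (A : Set (List ℕ)) : Ordinal.{0} :=
  sInf {α | derivIter A α = derivIter A (α + 1)}

/-- The ideal `WO(ℚ)` of well ordered (equivalently, well founded) subsets of `ℚ`. -/
def WOideal : Set (Set ℚ) := {A | A.IsWF}

/-- A subset of `ℚ` is scattered if `ℚ` does not order-embed into it. -/
def Scattered (A : Set ℚ) : Prop := ¬ ∃ f : ℚ → ℚ, (∀ q, f q ∈ A) ∧ StrictMono f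

/-- The dual filter of an ideal on `ℕ`. -/
def dualFilter (I : Set (Set ℕ)) : Set (Set ℕ) := {A | Aᶜ ∈ I}

/-- `U` is open in the topology `τ_F` on `ℕ^{<ω}` determined by the filter `F`. -/
def isTauOpen (F : Set (Set ℕ)) (U : Set (List ℕ)) : Prop :=
  ∀ s ∈ U, {n | s ++ [n] ∈ U} ∈ F


/-- The pullback of a family of sets along a map `f : ℕ → ℕ`. -/
def comapIdeal (f : ℕ → ℕ) (J : Set (Set ℕ)) : Set (Set ℕ) := {A | f '' A ∈ J}

/-- Either `K` is finite, or the restriction of `J` to `K` is a copy of a member of `B`. -/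
def RestrictsInto (B : Set (Set (Set ℕ))) (J : Set (Set ℕ)) (K : Set ℕ) : Prop :=
  K.Finite ∨ ∃ f : ℕ → ℕ, Function.Injective f ∧ range f = K ∧ comapIdeal f J ∈ B

theorem comapIdeal_comp (f g : ℕ → ℕ) (J : Set (Set ℕ)) :
    comapIdeal f (comapIdeal g J) = comapIdeal (g ∘ f) J := by
  ext A
  simp [comapIdeal, image_image]

theorem exists_injective_range_eq {K : Set ℕ} (hK : K.Infinite) :
    ∃ f : ℕ → ℕ, Function.Injective f ∧ range f = K :=
  ⟨Nat.nth (· ∈ K), Nat.nth_injective hK, Nat.range_nth_of_infinite hK⟩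

section Orthogonal

variable {X : Type*} {I : Set (Set X)}

theorem subset_orth_orth (I : Set (Set X)) : I ⊆ orth (orth I) := fun A hA B hB => by
  rw [inter_comm]
  exact hB A hA

theorem orth_antitone {I J : Set (Set X)} (h : I ⊆ J) : orth J ⊆ orth I :=
  fun _ hB A hA => hB A (h hA)

theorem isFrechet_orth (I : Set (Set X)) : IsFrechet (orth I) :=
  Subset.antisymm (orth_antitone (subset_orth_orth I)) (subset_orth_orth _)

theorem IsFrechet.mem_of_finite (h : IsFrechet I) {A : Set X} (hA : A.Finite) : A ∈ I := by
  rw [← h]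
  exact fun B _ => hA.subset inter_subset_right

theorem IsFrechet.mem_of_subset (h : IsFrechet I) {A B : Set X} (hA : A ∈ I) (hB : B ⊆ A) :
    B ∈ I := by
  rw [← h] at hA ⊢
  exact fun C hC => (hA C hC).subset (inter_subset_inter_right _ hB)

theorem IsFrechet.union_mem (h : IsFrechet I) {A B : Set X} (hA : A ∈ I) (hB : B ∈ I) :
    A ∪ B ∈ I := by
  rw [← h] at hA hB ⊢
  intro C hC
  rw [inter_union_distrib_left]
  exact (hA C hC).union (hB C hC)

theorem orth_univ : orth (univ : Set (Set X)) = {A | A.Finite} := by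
  ext B
  exact ⟨fun h => by simpa using h univ trivial, fun h A _ => h.subset inter_subset_right⟩

theorem orth_finite : orth {A : Set X | A.Finite} = univ :=
  eq_univ_of_forall fun _ _ hA => hA.subset inter_subset_left

end Orthogonal

theorem isFrechet_univ : IsFrechet (univ : Set (Set ℕ)) := by
  rw [IsFrechet, orth_univ, orth_finite]

theorem comapIdeal_orth {f : ℕ → ℕ} (hf : Function.Injective f) {J : Set (Set ℕ)}
    (hJ : IsFrechet J) : comapIdeal f (orth J) = orth (comapIdeal f J) := by
  ext B
  constructor
  · intro h A hA
    refine Finite.of_finite_image ?_ (hf.injOn (s := A ∩ B))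
    rw [image_inter hf]
    exact h _ hA
  · intro h C hC
    have := h (f ⁻¹' C) (hJ.mem_of_subset hC (image_preimage_subset f C))
    refine (this.image f).subset ?_
    rintro _ ⟨hx, b, hb, rfl⟩
    exact ⟨b, ⟨hx, hb⟩, rfl⟩

theorem image_preimage_eq_image_inter_range {h e f : ℕ → ℕ} (hh : Function.Injective h)
    (hc : ∀ m, h (e m) = f m) (A : Set ℕ) : f '' (e ⁻¹' A) = h '' A ∩ range f := by
  ext x
  constructor
  · rintro ⟨m, hm, rfl⟩
    exact ⟨⟨e m, hm, hc m⟩, m, rfl⟩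
  · rintro ⟨⟨a, ha, hax⟩, m, rfl⟩
    refine ⟨m, ?_, rfl⟩
    rw [← hc] at hax
    rw [mem_preimage, ← hh hax]
    exact ha

/-- Adding finitely many points to the underlying set does not change the isomorphism type. -/
theorem exists_comapIdeal_eq_of_union_finite {J : Set (Set ℕ)} (hJ : IsFrechet J) {f : ℕ → ℕ}
    (hf : Function.Injective f) {F : Set ℕ} (hF : F.Finite) :
    ∃ g : ℕ → ℕ, Function.Injective g ∧ range g = range f ∪ F ∧
      comapIdeal g J = comapIdeal f J := by
  classical
  wlog hd : Disjoint (range f) F generalizing F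
  · obtain ⟨g, hg, hr, hc⟩ := this (hF.subset (sdiff_subset (t := range f))) disjoint_sdiff_right
    exact ⟨g, hg, by rw [hr, union_sdiff_self], hc⟩
  by_cases hA : ∃ A ∈ comapIdeal f J, A.Infinite
  · obtain ⟨A, hAJ, hA⟩ := hA
    have := hA.to_subtype
    have hinf : (f '' A ∪ F).Infinite := (hA.image hf.injOn).mono subset_union_left
    have := hinf.to_subtype
    obtain ⟨e⟩ : Nonempty (A ≃ ↥(f '' A ∪ F)) := nonempty_equiv_of_countable
    let g : ℕ → ℕ := fun m => if h : m ∈ A then e ⟨m, h⟩ else f m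
    have g_mem : ∀ m (h : m ∈ A), g m = e ⟨m, h⟩ := fun m h => dif_pos h
    have g_not : ∀ m, m ∉ A → g m = f m := fun m h => dif_neg h
    have hne : ∀ m (h : m ∈ A), ∀ n, n ∉ A → (e ⟨m, h⟩ : ℕ) ≠ f n := by
      intro m h n hn heq
      rcases (e ⟨m, h⟩).2 with ⟨a, ha, hfa⟩ | hFm
      · rw [heq] at hfa
        exact hn (hf hfa ▸ ha)
      · rw [heq] at hFm
        exact disjoint_left.1 hd ⟨n, rfl⟩ hFm
    refine ⟨g, ?_, ?_, ?_⟩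
    · intro m n hmn
      by_cases hm : m ∈ A <;> by_cases hn : n ∈ A
      · rw [g_mem m hm, g_mem n hn] at hmn
        simpa using e.injective (Subtype.ext hmn)
      · rw [g_mem m hm, g_not n hn] at hmn
        exact absurd hmn (hne m hm n hn)
      · rw [g_not m hm, g_mem n hn] at hmn
        exact absurd hmn.symm (hne n hn m hm)
      · rw [g_not m hm, g_not n hn] at hmn
        exact hf hmn
    · ext x
      constructor
      · rintro ⟨m, rfl⟩
        by_cases hm : m ∈ A
        · rw [g_mem m hm]
          exact union_subset_union_left F (image_subset_range f A) (e ⟨m, hm⟩).2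
        · rw [g_not m hm]
          exact Or.inl ⟨m, rfl⟩
      · intro hx
        by_cases hx' : x ∈ f '' A ∪ F
        · obtain ⟨a, ha⟩ := e.surjective ⟨x, hx'⟩
          exact ⟨a, by rw [g_mem a a.2, Subtype.coe_eta, ha]⟩
        · rcases hx with ⟨m, rfl⟩ | hx
          · exact ⟨m, g_not m fun hm => hx' (Or.inl ⟨m, hm, rfl⟩)⟩
          · exact absurd (Or.inr hx) hx'
    · ext B
      have hout : g '' (B \ A) = f '' (B \ A) := image_congr fun m hm => g_not m hm.2
      have hgB : g '' B ∈ J ↔ f '' (B \ A) ∈ J := by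
        constructor
        · intro h
          rw [← hout]
          exact hJ.mem_of_subset h (image_mono sdiff_subset)
        · intro h
          refine hJ.mem_of_subset (hJ.union_mem h (hJ.union_mem hAJ (hJ.mem_of_finite hF))) ?_
          rintro _ ⟨m, hm, rfl⟩
          by_cases hmA : m ∈ A
          · rw [g_mem m hmA]
            exact Or.inr (e ⟨m, hmA⟩).2
          · exact Or.inl (hout ▸ ⟨m, ⟨hm, hmA⟩, rfl⟩)
      have hfB : f '' B ∈ J ↔ f '' (B \ A) ∈ J := by
        constructor
        · exact fun h => hJ.mem_of_subset h (image_mono sdiff_subset)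
        · intro h
          refine hJ.mem_of_subset (hJ.union_mem h hAJ) ?_
          rw [← image_union]
          exact image_mono (by simp)
      exact hgB.trans hfB.symm
  · push Not at hA
    have hinf : (range f ∪ F).Infinite := (infinite_range_of_injective hf).mono subset_union_left
    obtain ⟨g, hg, hr⟩ := exists_injective_range_eq hinf
    refine ⟨g, hg, hr, ?_⟩
    ext B
    constructor
    · intro h
      have h1 : (f ⁻¹' (g '' B)).Finite :=
        hA _ (hJ.mem_of_subset h (image_preimage_subset _ _))
      have h2 : (g '' B).Finite := by
        refine ((h1.image f).union hF).subset ?_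
        intro x hx
        rcases hr ▸ image_subset_range g B hx with ⟨m, rfl⟩ | hxF
        · exact Or.inl ⟨m, hx, rfl⟩
        · exact Or.inr hxF
      exact hJ.mem_of_finite ((h2.of_finite_image hg.injOn).image f)
    · exact fun h => hJ.mem_of_finite ((hA B h).image g)

theorem RestrictsInto.union_finite {B : Set (Set (Set ℕ))} {J : Set (Set ℕ)} {K F : Set ℕ}
    (hJ : IsFrechet J) (hK : RestrictsInto B J K) (hF : F.Finite) :
    RestrictsInto B J (K ∪ F) := by
  rcases hK with hK | ⟨f, hf, rfl, hB⟩
  · exact Or.inl (hK.union hF)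
  · obtain ⟨g, hg, hr, hc⟩ := exists_comapIdeal_eq_of_union_finite hJ hf hF
    exact Or.inr ⟨g, hg, hr, hc ▸ hB⟩

section Sums

theorem finSumN_block_injective (k i : ℕ) :
    Function.Injective fun m : ℕ => m * (k + 1) + i := by
  intro m n h
  simpa using h

theorem finSumN_block_inj {k i j m n : ℕ} (hi : i ≤ k) (hj : j ≤ k)
    (h : m * (k + 1) + i = n * (k + 1) + j) : m = n ∧ i = j := by
  have hmod := congrArg (· % (k + 1)) h
  simp only [Nat.mul_add_mod_self_right, Nat.mod_eq_of_lt (Nat.lt_succ_of_le hi),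
    Nat.mod_eq_of_lt (Nat.lt_succ_of_le hj)] at hmod
  subst hmod
  exact ⟨by simpa using h, rfl⟩

theorem comapIdeal_finSumN {k : ℕ} {I : ℕ → Set (Set ℕ)} (hI : ∀ i ≤ k, ∅ ∈ I i)
    {i : ℕ} (hi : i ≤ k) : comapIdeal (fun m => m * (k + 1) + i) (finSumN k I) = I i := by
  have key (A : Set ℕ) (j : ℕ) (hj : j ≤ k) :
      {m | m * (k + 1) + j ∈ (fun m => m * (k + 1) + i) '' A} = {m | m ∈ A ∧ j = i} := by
    ext m
    constructor
    · rintro ⟨n, hn, h⟩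
      obtain ⟨rfl, rfl⟩ := finSumN_block_inj hi hj h
      exact ⟨hn, rfl⟩
    · rintro ⟨hm, rfl⟩
      exact ⟨m, hm, rfl⟩
  ext A
  constructor
  · intro h
    have := h i hi
    rw [key A i hi] at this
    simpa using this
  · intro h j hj
    rw [key A j hj]
    by_cases hji : j = i
    · subst hji
      simpa using h
    · simpa [hji] using hI j hj

theorem comapIdeal_directSumN {I : ℕ → Set (Set ℕ)} (hI : ∀ n, ∅ ∈ I n) (n : ℕ) :
    comapIdeal (Nat.pair n) (directSumN I) = I n := by
  have key (A : Set ℕ) (j : ℕ) : {m | Nat.pair j m ∈ Nat.pair n '' A} = {m | m ∈ A ∧ j = n} := by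
    ext m
    simp only [mem_image, mem_ofPred_eq, Nat.pair_eq_pair]
    grind
  ext A
  constructor
  · intro h
    have := h n
    rw [key A n] at this
    simpa using this
  · intro h j
    rw [key A j]
    by_cases hjn : j = n
    · subst hjn
      simpa using h
    · simpa [hjn] using hI j

theorem image_mem_orth {e : ℕ → ℕ} {J I : Set (Set ℕ)}
    (h : ∀ A ∈ J, e ⁻¹' A ∈ I) {B : Set ℕ} (hB : B ∈ orth I) : e '' B ∈ orth J := by
  intro A hA
  refine ((hB _ (h A hA)).image e).subset ?_
  rintro _ ⟨hx, b, hb, rfl⟩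
  exact ⟨b, ⟨hx, hb⟩, rfl⟩

theorem preimage_mem_orth {e : ℕ → ℕ} (he : Function.Injective e) {J I : Set (Set ℕ)}
    (h : ∀ B ∈ I, e '' B ∈ J) {A : Set ℕ} (hA : A ∈ orth J) : e ⁻¹' A ∈ orth I := by
  intro B hB
  refine Finite.of_finite_image ((hA _ (h B hB)).subset ?_) he.injOn
  rintro _ ⟨b, ⟨hb, hb'⟩, rfl⟩
  exact ⟨⟨b, hb, rfl⟩, hb'⟩

theorem isFrechet_directSumN {I : ℕ → Set (Set ℕ)} (hI : ∀ n, IsFrechet (I n)) :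
    IsFrechet (directSumN I) := by
  refine Subset.antisymm (fun A hA n => ?_) (subset_orth_orth _)
  rw [← hI n]
  have he : Function.Injective (Nat.pair n) := fun a b h => (Nat.pair_eq_pair.1 h).2
  exact preimage_mem_orth he
    (fun _ => image_mem_orth (J := directSumN I) fun _ hC => hC n) hA

theorem isFrechet_finSumN {k : ℕ} {I : ℕ → Set (Set ℕ)} (hI : ∀ i ≤ k, IsFrechet (I i)) :
    IsFrechet (finSumN k I) := by
  refine Subset.antisymm (fun A hA i hi => ?_) (subset_orth_orth _)
  rw [← hI i hi]
  have he := finSumN_block_injective k i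
  exact preimage_mem_orth he
    (fun _ => image_mem_orth (J := finSumN k I) fun _ hC => hC i hi) hA

theorem orth_finSumN {k : ℕ} {I : ℕ → Set (Set ℕ)} (hI : ∀ i ≤ k, IsFrechet (I i)) :
    orth (finSumN k I) = finSumN k fun i => orth (I i) := by
  ext B
  constructor
  · intro hB i hi
    refine preimage_mem_orth (finSumN_block_injective k i) (fun A hA => ?_) hB
    rw [← comapIdeal_finSumN (fun j hj => (hI j hj).mem_of_finite finite_empty) hi] at hA
    exact hA
  · intro hB A hA
    have : (⋃ i ∈ Iic k, (fun m => m * (k + 1) + i) ''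
        ({m | m * (k + 1) + i ∈ A} ∩ {m | m * (k + 1) + i ∈ B})).Finite :=
      (finite_Iic k).biUnion fun i hi => (hB i hi _ (hA i hi)).image _
    refine this.subset fun x hx => ?_
    have hx' : x / (k + 1) * (k + 1) + x % (k + 1) = x := Nat.div_add_mod' x (k + 1)
    refine mem_biUnion (x := x % (k + 1)) (Nat.lt_succ_iff.1 (Nat.mod_lt _ k.succ_pos))
      ⟨x / (k + 1), ?_, hx'⟩
    simpa [hx'] using hx

end Sums

section Step

variable {U : Set (Set (Set ℕ))}

theorem isFrechet_of_mem_sumsOf (hU : ∀ I ∈ U, IsFrechet I) {J : Set (Set ℕ)}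
    (hJ : J ∈ sumsOf U) : IsFrechet J := by
  obtain ⟨I, hI, rfl⟩ := hJ
  exact isFrechet_directSumN fun n => hU _ (hI n)

theorem isFrechet_of_mem_sumsPerpOf (hU : ∀ I ∈ U, IsFrechet I) {J : Set (Set ℕ)}
    (hJ : J ∈ sumsPerpOf U) : IsFrechet J := by
  rcases hJ with hJ | ⟨I, -, rfl⟩
  · exact isFrechet_of_mem_sumsOf hU hJ
  · exact isFrechet_orth I

theorem isFrechet_of_mem_BstepOf (hU : ∀ I ∈ U, IsFrechet I) {J : Set (Set ℕ)}
    (hJ : J ∈ BstepOf U) : IsFrechet J := by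
  obtain ⟨k, I, hI, rfl⟩ := hJ
  exact isFrechet_finSumN fun i hi => isFrechet_of_mem_sumsPerpOf hU (hI i hi)

theorem orth_mem_sumsPerpOf (hU : ∀ I ∈ U, IsFrechet I) {J : Set (Set ℕ)}
    (hJ : J ∈ sumsPerpOf U) : orth J ∈ sumsPerpOf U := by
  rcases hJ with hJ | ⟨I, hI, rfl⟩
  · exact Or.inr ⟨J, hJ, rfl⟩
  · rw [isFrechet_of_mem_sumsOf hU hI]
    exact Or.inl hI

theorem orth_mem_BstepOf (hU : ∀ I ∈ U, IsFrechet I) {J : Set (Set ℕ)}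
    (hJ : J ∈ BstepOf U) : orth J ∈ BstepOf U := by
  obtain ⟨k, I, hI, rfl⟩ := hJ
  exact ⟨k, fun i => orth (I i), fun i hi => orth_mem_sumsPerpOf hU (hI i hi),
    orth_finSumN fun i hi => isFrechet_of_mem_sumsPerpOf hU (hI i hi)⟩

theorem sumsPerpOf_subset_BstepOf : sumsPerpOf U ⊆ BstepOf U := by
  intro J hJ
  exact ⟨0, fun _ => J, fun _ _ => hJ, by simp [finSumN]⟩

theorem sumsPerpOf_mono {V : Set (Set (Set ℕ))} (h : U ⊆ V) : sumsPerpOf U ⊆ sumsPerpOf V := by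
  rintro J (⟨I, hI, rfl⟩ | ⟨_, ⟨I, hI, rfl⟩, rfl⟩)
  · exact Or.inl ⟨I, fun n => h (hI n), rfl⟩
  · exact Or.inr ⟨_, ⟨I, fun n => h (hI n), rfl⟩, rfl⟩

theorem BstepOf_mono {V : Set (Set (Set ℕ))} (h : U ⊆ V) : BstepOf U ⊆ BstepOf V := by
  rintro J ⟨k, I, hI, rfl⟩
  exact ⟨k, I, fun i hi => sumsPerpOf_mono h (hI i hi), rfl⟩

theorem RestrictsInto.orth {J : Set (Set ℕ)} {K : Set ℕ} (hU : ∀ I ∈ U, IsFrechet I)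
    (hJ : IsFrechet J) (h : RestrictsInto (BstepOf U) J K) :
    RestrictsInto (BstepOf U) (orth J) K := by
  refine h.imp_right ?_
  rintro ⟨f, hf, hr, hB⟩
  exact ⟨f, hf, hr, comapIdeal_orth hf hJ ▸ orth_mem_BstepOf hU hB⟩

theorem RestrictsInto.union {J : Set (Set ℕ)} {K L : Set ℕ} (hJ : IsFrechet J)
    (hd : Disjoint K L) (hK : RestrictsInto (BstepOf U) J K)
    (hL : RestrictsInto (BstepOf U) J L) : RestrictsInto (BstepOf U) J (K ∪ L) := by
  rcases hL with hL | hL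
  · exact hK.union_finite hJ hL
  rcases hK with hK | hK
  · rw [union_comm]
    exact RestrictsInto.union_finite hJ (Or.inr hL) hK
  obtain ⟨f, hf, rfl, k, I, hI, hfI⟩ := hK
  obtain ⟨g, hg, rfl, l, I', hI', hgI⟩ := hL
  let N := k + l + 1
  let h : ℕ → ℕ := fun x => if x % (N + 1) ≤ k then f (x / (N + 1) * (k + 1) + x % (N + 1))
    else g (x / (N + 1) * (l + 1) + (x % (N + 1) - (k + 1)))
  have hmod : ∀ m i, i ≤ N → (m * (N + 1) + i) % (N + 1) = i := fun m i hi => by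
    rw [Nat.mul_add_mod_self_right, Nat.mod_eq_of_lt (Nat.lt_succ_of_le hi)]
  have hdiv : ∀ m i, i ≤ N → (m * (N + 1) + i) / (N + 1) = m := fun m i hi => by
    rw [mul_comm, Nat.mul_add_div N.succ_pos, Nat.div_eq_of_lt (Nat.lt_succ_of_le hi), add_zero]
  have h_left : ∀ m i, i ≤ k → h (m * (N + 1) + i) = f (m * (k + 1) + i) := by
    intro m i hi
    have hiN : i ≤ N := by omega
    simp only [h, hmod m i hiN, hdiv m i hiN, if_pos hi]
  have h_right : ∀ m i, i ≤ l → h (m * (N + 1) + (k + 1 + i)) = g (m * (l + 1) + i) := by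
    intro m i hi
    have hiN : k + 1 + i ≤ N := by omega
    have hik : ¬ k + 1 + i ≤ k := by omega
    simp only [h, hmod m _ hiN, hdiv m _ hiN, if_neg hik, Nat.add_sub_cancel_left]
  have hcases : ∀ x, (∃ m i, i ≤ k ∧ x = m * (N + 1) + i) ∨
      ∃ m i, i ≤ l ∧ x = m * (N + 1) + (k + 1 + i) := by
    intro x
    have hx := (Nat.div_add_mod' x (N + 1)).symm
    have hlt : x % (N + 1) < k + l + 1 + 1 := Nat.mod_lt x N.succ_pos
    by_cases hk : x % (N + 1) ≤ k
    · exact Or.inl ⟨_, _, hk, hx⟩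
    · refine Or.inr ⟨x / (N + 1), x % (N + 1) - (k + 1), by omega, ?_⟩
      rwa [Nat.add_sub_cancel' (by omega)]
  have hfg : ∀ a b, f a ≠ g b := fun a b hab => disjoint_left.1 hd ⟨a, rfl⟩ ⟨b, hab.symm⟩
  have hh : Function.Injective h := by
    intro x y hxy
    obtain ⟨m, i, hi, rfl⟩ | ⟨m, i, hi, rfl⟩ := hcases x <;>
    obtain ⟨n, j, hj, rfl⟩ | ⟨n, j, hj, rfl⟩ := hcases y
    · rw [h_left m i hi, h_left n j hj] at hxy
      obtain ⟨rfl, rfl⟩ := finSumN_block_inj hi hj (hf hxy)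
      rfl
    · rw [h_left m i hi, h_right n j hj] at hxy
      exact absurd hxy (hfg _ _)
    · rw [h_right m i hi, h_left n j hj] at hxy
      exact absurd hxy.symm (hfg _ _)
    · rw [h_right m i hi, h_right n j hj] at hxy
      obtain ⟨rfl, rfl⟩ := finSumN_block_inj hi hj (hg hxy)
      rfl
  have hf_range : ∀ a, ∃ x, h x = f a := fun a =>
    ⟨_, (h_left (a / (k + 1)) (a % (k + 1)) (Nat.lt_succ_iff.1 (Nat.mod_lt _ k.succ_pos))).trans
      (by rw [Nat.div_add_mod'])⟩
  have hg_range : ∀ a, ∃ x, h x = g a := fun a =>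
    ⟨_, (h_right (a / (l + 1)) (a % (l + 1)) (Nat.lt_succ_iff.1 (Nat.mod_lt _ l.succ_pos))).trans
      (by rw [Nat.div_add_mod'])⟩
  have hr : range h = range f ∪ range g := by
    refine Subset.antisymm ?_ (union_subset ?_ ?_)
    · rintro _ ⟨x, rfl⟩
      obtain ⟨m, i, hi, rfl⟩ | ⟨m, i, hi, rfl⟩ := hcases x
      · exact Or.inl ⟨_, (h_left m i hi).symm⟩
      · exact Or.inr ⟨_, (h_right m i hi).symm⟩
    · rintro _ ⟨a, rfl⟩
      exact hf_range a
    · rintro _ ⟨a, rfl⟩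
      exact hg_range a
  refine Or.inr ⟨h, hh, hr, N, fun i => if i ≤ k then I i else I' (i - (k + 1)), ?_, ?_⟩
  · intro i hi
    by_cases hik : i ≤ k
    · simpa only [if_pos hik] using hI i hik
    · simpa only [if_neg hik] using hI' (i - (k + 1)) (by omega)
  · ext A
    have hsplit : h '' A ∈ J ↔ f ⁻¹' (h '' A) ∈ comapIdeal f J ∧
        g ⁻¹' (h '' A) ∈ comapIdeal g J := by
      constructor
      · exact fun hA => ⟨hJ.mem_of_subset hA (image_preimage_subset _ _),
          hJ.mem_of_subset hA (image_preimage_subset _ _)⟩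
      · rintro ⟨h1, h2⟩
        refine hJ.mem_of_subset (hJ.union_mem h1 h2) fun x hx => ?_
        rcases hr ▸ image_subset_range h A hx with ⟨a, rfl⟩ | ⟨a, rfl⟩
        · exact Or.inl ⟨a, hx, rfl⟩
        · exact Or.inr ⟨a, hx, rfl⟩
    change h '' A ∈ J ↔ _
    rw [hsplit, hfI, hgI]
    have e1 : ∀ i ≤ k, {m | m * (k + 1) + i ∈ f ⁻¹' (h '' A)} = {m | m * (N + 1) + i ∈ A} := by
      intro i hi
      ext m
      simp only [mem_ofPred_eq, mem_preimage, ← h_left m i hi, hh.mem_set_image]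
    have e2 : ∀ i ≤ l, {m | m * (l + 1) + i ∈ g ⁻¹' (h '' A)} =
        {m | m * (N + 1) + (k + 1 + i) ∈ A} := by
      intro i hi
      ext m
      simp only [mem_ofPred_eq, mem_preimage, ← h_right m i hi, hh.mem_set_image]
    constructor
    · rintro ⟨h1, h2⟩ i hi
      by_cases hik : i ≤ k
      · simp only [if_pos hik]
        rw [← e1 i hik]
        exact h1 i hik
      · have hil : i - (k + 1) ≤ l := by omega
        have := h2 _ hil
        rw [e2 _ hil, Nat.add_sub_cancel' (by omega)] at this
        simpa only [if_neg hik] using this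
    · intro hA
      refine ⟨fun i hi => ?_, fun i hi => ?_⟩
      · have := hA i (by omega)
        simp only [if_pos hi] at this
        rw [e1 i hi]
        exact this
      · have := hA (k + 1 + i) (by omega)
        have hik : ¬ k + 1 + i ≤ k := by omega
        simp only [if_neg hik, Nat.add_sub_cancel_left] at this
        rw [e2 i hi]
        exact this

theorem RestrictsInto.biUnion {ι : Type*} {J : Set (Set ℕ)} (hJ : IsFrechet J) {K : ι → Set ℕ}
    (hd : Pairwise (Function.onFun Disjoint K)) (s : Finset ι)
    (h : ∀ i ∈ s, RestrictsInto (BstepOf U) J (K i)) :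
    RestrictsInto (BstepOf U) J (⋃ i ∈ s, K i) := by
  classical
  induction s using Finset.induction_on with
  | empty => exact Or.inl (by simp)
  | insert a s ha ih =>
    rw [Finset.set_biUnion_insert]
    refine (h a (Finset.mem_insert_self a s)).union hJ ?_
      (ih fun i hi => h i (Finset.mem_insert_of_mem hi))
    simp only [disjoint_iUnion_right]
    exact fun i hi => hd fun hai => ha (hai ▸ hi)

theorem RestrictsInto.of_comap {B : Set (Set (Set ℕ))} {J : Set (Set ℕ)} {e : ℕ → ℕ}
    (he : Function.Injective e) {K : Set ℕ} (h : RestrictsInto B (comapIdeal e J) (e ⁻¹' K)) :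
    RestrictsInto B J (K ∩ range e) := by
  rw [← Set.image_preimage_eq_inter_range]
  rcases h with h | ⟨f, hf, hr, hB⟩
  · exact Or.inl (h.image e)
  · exact Or.inr ⟨e ∘ f, he.comp hf, by rw [range_comp, hr], comapIdeal_comp f e J ▸ hB⟩

theorem restrictsInto_directSumN (hU : ∀ I ∈ U, IsFrechet I)
    (hR : ∀ I ∈ U, ∀ K, RestrictsInto U I K) (hUB : U ⊆ BstepOf U) (huniv : univ ∈ BstepOf U)
    {I : ℕ → Set (Set ℕ)} (hI : ∀ n, I n ∈ U) (K : Set ℕ) :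
    RestrictsInto (BstepOf U) (directSumN I) K := by
  have hJ : IsFrechet (directSumN I) := isFrechet_directSumN fun n => hU _ (hI n)
  have hpair (n : ℕ) : Function.Injective (Nat.pair n) := fun a b h => (Nat.pair_eq_pair.1 h).2
  have mem_J {A : Set ℕ} (h : ∀ n, A ∩ range (Nat.pair n) ∈ directSumN I) :
      A ∈ directSumN I := fun n => by
    have := h n n
    simpa using this
  let P : ℕ → Set ℕ := fun n => K ∩ range (Nat.pair n)
  have hP (n : ℕ) : RestrictsInto U (directSumN I) (P n) := by
    refine RestrictsInto.of_comap (hpair n) ?_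
    rw [comapIdeal_directSumN fun n => (hU _ (hI n)).mem_of_finite finite_empty]
    exact hR _ (hI n) _
  have hPd {m n x : ℕ} (hm : x ∈ range (Nat.pair m)) (hn : x ∈ range (Nat.pair n)) : m = n := by
    obtain ⟨a, rfl⟩ := hm
    obtain ⟨b, hb⟩ := hn
    exact (Nat.pair_eq_pair.1 hb).1.symm
  let N : Set ℕ := {n | (P n).Infinite}
  let F : Set ℕ := {x ∈ K | x.unpair.1 ∉ N}
  have hrange (x : ℕ) : x ∈ range (Nat.pair x.unpair.1) := ⟨x.unpair.2, Nat.pair_unpair x⟩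
  have hFfin (n : ℕ) : (F ∩ range (Nat.pair n)).Finite := by
    by_cases hn : n ∈ N
    · convert finite_empty
      refine eq_empty_of_forall_notMem fun x hx => hx.1.2 ?_
      rwa [hPd (hrange x) hx.2]
    · exact (not_infinite.1 hn).subset (inter_subset_inter_left _ fun x hx => hx.1)
  by_cases hN : N.Finite
  · have hF : RestrictsInto (BstepOf U) (directSumN I) F := by
      by_cases hF : F.Finite
      · exact Or.inl hF
      obtain ⟨f, hf, hr⟩ := exists_injective_range_eq hF
      refine Or.inr ⟨f, hf, hr, ?_⟩
      convert huniv
      refine eq_univ_of_forall fun A => mem_J fun n => hJ.mem_of_finite ?_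
      exact (hFfin n).subset (inter_subset_inter_left _ (hr ▸ image_subset_range f A))
    have hPN : RestrictsInto (BstepOf U) (directSumN I) (⋃ n ∈ hN.toFinset, P n) := by
      refine RestrictsInto.biUnion hJ (fun m n hmn => ?_) _ fun n _ => ?_
      · exact disjoint_left.2 fun x hm hn => hmn (hPd hm.2 hn.2)
      · exact (hP n).imp_right fun ⟨f, hf, hr, h⟩ => ⟨f, hf, hr, hUB h⟩
    convert hPN.union hJ ?_ hF
    · ext x
      simp only [mem_union, mem_iUnion, Finite.mem_toFinset, exists_prop]
      constructor
      · intro hx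
        by_cases hxN : x.unpair.1 ∈ N
        · exact Or.inl ⟨_, hxN, hx, hrange x⟩
        · exact Or.inr ⟨hx, hxN⟩
      · rintro (⟨_, _, hx, _⟩ | hx)
        · exact hx
        · exact hx.1
    · simp only [disjoint_iUnion_left, Finite.mem_toFinset]
      intro n hn
      refine disjoint_left.2 fun x hx hxF => hxF.2 ?_
      rwa [hPd (hrange x) hx.2]
  · obtain ⟨φ, hφ, hφr⟩ := exists_injective_range_eq hN
    have hφN (j : ℕ) : φ j ∈ N := hφr ▸ mem_range_self j
    -- the points lying in finite blocks are distributed among the infinite ones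
    let L : ℕ → Set ℕ := fun j => P (φ j) ∪ F ∩ {j}
    have hFj (j : ℕ) : (F ∩ {j}).Finite := (finite_singleton j).inter_of_right F
    have hL (j : ℕ) : ∃ f : ℕ → ℕ, Function.Injective f ∧ range f = L j ∧
        comapIdeal f (directSumN I) ∈ U :=
      ((hP (φ j)).union_finite hJ (hFj j)).resolve_left
        ((hφN j).mono subset_union_left)
    choose f hf hr hfU using hL
    have hLd {i j x : ℕ} (hi : x ∈ L i) (hj : x ∈ L j) : i = j := by
      have key {i : ℕ} (h : x ∈ P (φ i)) : x ∉ F := fun hF => hF.2 (by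
        rw [hPd (hrange x) h.2]
        exact hφN i)
      rcases hi with hi | hi <;> rcases hj with hj | hj
      · exact hφ (hPd hi.2 hj.2)
      · exact absurd hj.1 (key hi)
      · exact absurd hi.1 (key hj)
      · exact (mem_singleton_iff.1 hi.2).symm.trans (mem_singleton_iff.1 hj.2)
    have hLK (j : ℕ) : L j ⊆ K := union_subset inter_subset_left fun x hx => hx.1.1
    let h : ℕ → ℕ := fun x => f x.unpair.1 x.unpair.2
    have h_pair (j m : ℕ) : h (Nat.pair j m) = f j m := by simp [h]
    have h_mem (x : ℕ) : h x ∈ L x.unpair.1 := hr x.unpair.1 ▸ mem_range_self x.unpair.2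
    have hh : Function.Injective h := by
      intro x y hxy
      have h1 : x.unpair.1 = y.unpair.1 := hLd (h_mem x) (hxy ▸ h_mem y)
      have h2 : x.unpair.2 = y.unpair.2 := by
        simp only [h, h1] at hxy
        exact hf _ hxy
      rw [← Nat.pair_unpair x, h1, h2, Nat.pair_unpair]
    have hhr : range h = K := by
      refine Subset.antisymm (range_subset_iff.2 fun x => hLK _ (h_mem x)) fun x hx => ?_
      obtain ⟨j, hj⟩ : ∃ j, x ∈ L j := by
        by_cases hxN : x.unpair.1 ∈ N
        · obtain ⟨j, hj⟩ := hφr.symm ▸ hxN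
          exact ⟨j, Or.inl ⟨hx, hj ▸ hrange x⟩⟩
        · exact ⟨x, Or.inr ⟨⟨hx, hxN⟩, rfl⟩⟩
      rw [← hr j] at hj
      obtain ⟨m, rfl⟩ := hj
      exact ⟨_, h_pair j m⟩
    refine Or.inr ⟨h, hh, hhr, sumsPerpOf_subset_BstepOf (Or.inl ⟨_, hfU, ?_⟩)⟩
    ext A
    have hblock (j : ℕ) : f j '' {m | Nat.pair j m ∈ A} = h '' A ∩ L j :=
      (image_preimage_eq_image_inter_range hh (h_pair j) A).trans (by rw [hr])
    constructor
    · intro hA j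
      refine hJ.mem_of_subset hA ?_
      rw [hblock]
      exact inter_subset_left
    · intro hA
      refine mem_J fun n => ?_
      by_cases hn : n ∈ N
      · obtain ⟨j, rfl⟩ := hφr.symm ▸ hn
        refine hJ.mem_of_subset (hA j) ?_
        rw [hblock]
        exact fun x hx => ⟨hx.1, Or.inl ⟨hhr ▸ image_subset_range h A hx.1, hx.2⟩⟩
      · refine hJ.mem_of_finite ((not_infinite.1 hn).subset ?_)
        exact inter_subset_inter_left _ (hhr ▸ image_subset_range h A)

theorem restrictsInto_BstepOf (hU : ∀ I ∈ U, IsFrechet I)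
    (hR : ∀ I ∈ U, ∀ K, RestrictsInto U I K) (hUB : U ⊆ BstepOf U) (huniv : univ ∈ BstepOf U)
    {J : Set (Set ℕ)} (hJ : J ∈ BstepOf U) (K : Set ℕ) : RestrictsInto (BstepOf U) J K := by
  have hfr := isFrechet_of_mem_BstepOf hU hJ
  obtain ⟨k, I, hI, rfl⟩ := hJ
  have hIf (i : ℕ) (hi : i ≤ k) : IsFrechet (I i) := isFrechet_of_mem_sumsPerpOf hU (hI i hi)
  have hsum {J : Set (Set ℕ)} (hJ : J ∈ sumsPerpOf U) (L : Set ℕ) :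
      RestrictsInto (BstepOf U) J L := by
    rcases hJ with ⟨I, hI, rfl⟩ | ⟨_, ⟨I, hI, rfl⟩, rfl⟩
    · exact restrictsInto_directSumN hU hR hUB huniv hI L
    · exact (restrictsInto_directSumN hU hR hUB huniv hI L).orth hU
        (isFrechet_directSumN fun n => hU _ (hI n))
  let P : Fin (k + 1) → Set ℕ := fun i => K ∩ range fun m => m * (k + 1) + i
  have hP : RestrictsInto (BstepOf U) (finSumN k I) (⋃ i ∈ Finset.univ, P i) := by
    refine RestrictsInto.biUnion hfr (fun i j hij => ?_) _ fun i _ => ?_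
    · refine disjoint_left.2 ?_
      rintro x ⟨_, m, hm⟩ ⟨_, n, hn⟩
      exact hij (Fin.ext (finSumN_block_inj i.is_le j.is_le (hm.trans hn.symm)).2)
    · refine RestrictsInto.of_comap (finSumN_block_injective k i) ?_
      rw [comapIdeal_finSumN (fun j hj => (hIf j hj).mem_of_finite finite_empty) i.is_le]
      exact hsum (hI i i.is_le) _
  convert hP
  ext x
  simp only [Finset.mem_univ, iUnion_true, mem_iUnion]
  exact ⟨fun hx => ⟨⟨x % (k + 1), Nat.mod_lt _ k.succ_pos⟩, hx, x / (k + 1),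
    Nat.div_add_mod' x (k + 1)⟩, fun ⟨_, hx⟩ => hx.1⟩

end Step

section Hierarchy

theorem Bfam_zero : Bfam 0 = {univ, finIdeal, sum2 univ finIdeal} := by
  rw [Bfam, WellFounded.fix_eq, if_pos rfl]

theorem Bfam_of_ne_zero {α : Ordinal.{0}} (hα : α ≠ 0) :
    Bfam α = BstepOf {I | ∃ ξ < α, I ∈ Bfam ξ} := by
  rw [Bfam, WellFounded.fix_eq, if_neg hα]
  simp only [exists_prop]

theorem mem_sum2_univ_finIdeal {A : Set ℕ} :
    A ∈ sum2 univ finIdeal ↔ (A ∩ range fun m => 2 * m + 1).Finite := by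
  have hinj : Function.Injective fun m : ℕ => 2 * m + 1 := fun a b h => by simpa using h
  rw [← Set.image_preimage_eq_inter_range, finite_image_iff hinj.injOn]
  exact ⟨fun h => h.2, fun h => ⟨trivial, h⟩⟩

theorem sum2_eq_finSumN :
    sum2 univ finIdeal = finSumN 1 fun i => if i = 0 then univ else finIdeal := by
  ext A
  constructor
  · rintro ⟨-, h⟩ i hi
    interval_cases i
    · trivial
    · simpa [mul_comm] using h
  · intro h
    exact ⟨trivial, by simpa [mul_comm] using h 1 le_rfl⟩

theorem isFrechet_finIdeal : IsFrechet finIdeal := by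
  rw [finIdeal, ← orth_univ]
  exact isFrechet_orth _

theorem isFrechet_of_mem_Bfam {α : Ordinal.{0}} {I : Set (Set ℕ)} (hI : I ∈ Bfam α) :
    IsFrechet I := by
  induction α using WellFoundedLT.induction generalizing I with
  | ind α ih =>
    by_cases hα : α = 0
    · subst hα
      rw [Bfam_zero] at hI
      rcases hI with rfl | rfl | rfl
      · exact isFrechet_univ
      · exact isFrechet_finIdeal
      · rw [sum2_eq_finSumN]
        refine isFrechet_finSumN fun i _ => ?_
        split_ifs
        exacts [isFrechet_univ, isFrechet_finIdeal]
    · rw [Bfam_of_ne_zero hα] at hI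
      refine isFrechet_of_mem_BstepOf ?_ hI
      rintro J ⟨ξ, hξ, hJ⟩
      exact ih ξ hξ hJ

theorem Bfam_zero_subset_BstepOf {U : Set (Set (Set ℕ))} (hU : univ ∈ U) :
    Bfam 0 ⊆ BstepOf U := by
  have h1 : univ ∈ sumsOf U := ⟨fun _ => univ, fun _ => hU, by simp [directSumN]⟩
  have h2 : finIdeal ∈ sumsPerpOf U := Or.inr ⟨univ, h1, by rw [orth_univ, finIdeal]⟩
  rw [Bfam_zero]
  rintro I (rfl | rfl | rfl)
  · exact sumsPerpOf_subset_BstepOf (Or.inl h1)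
  · exact sumsPerpOf_subset_BstepOf h2
  · refine ⟨1, _, fun i _ => ?_, sum2_eq_finSumN⟩
    split_ifs
    exacts [Or.inl h1, h2]

theorem restrictsInto_Bfam_zero {I : Set (Set ℕ)} (hI : I ∈ Bfam 0) (K : Set ℕ) :
    RestrictsInto (Bfam 0) I K := by
  have hfr := isFrechet_of_mem_Bfam hI
  by_cases hK : K.Finite
  · exact Or.inl hK
  obtain ⟨f, hf, hr⟩ := exists_injective_range_eq hK
  rw [Bfam_zero] at hI ⊢
  have comap_fin {f : ℕ → ℕ} (hf : Function.Injective f) : comapIdeal f finIdeal = finIdeal := by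
    ext A
    exact finite_image_iff hf.injOn
  rcases hI with rfl | rfl | rfl
  · exact Or.inr ⟨f, hf, hr, Or.inl rfl⟩
  · exact Or.inr ⟨f, hf, hr, Or.inr (Or.inl (comap_fin hf))⟩
  · let E : Set ℕ := {x ∈ K | Even x}
    let O : Set ℕ := K ∩ range fun m => 2 * m + 1
    have hEO : K = E ∪ O := by
      ext x
      constructor
      · intro hx
        rcases Nat.even_or_odd x with h | ⟨m, hm⟩
        · exact Or.inl ⟨hx, h⟩
        · exact Or.inr ⟨hx, m, hm.symm⟩
      · rintro (h | h) <;> exact h.1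
    have hd {x : ℕ} (hE : x ∈ E) : x ∉ range fun m => 2 * m + 1 := by
      rintro ⟨m, rfl⟩
      have := hE.2
      simp at this
    have mem_E {A : Set ℕ} (hA : A ⊆ E) : A ∈ sum2 univ finIdeal := by
      rw [mem_sum2_univ_finIdeal]
      convert finite_empty
      exact eq_empty_of_forall_notMem fun x hx => hd (hA hx.1) hx.2
    have mem_O {A : Set ℕ} (hA : A ⊆ O) : A ∈ sum2 univ finIdeal ↔ A.Finite := by
      rw [mem_sum2_univ_finIdeal, inter_eq_left.2 (hA.trans inter_subset_right)]
    have hE : RestrictsInto {univ} (sum2 univ finIdeal) E := by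
      by_cases hE : E.Finite
      · exact Or.inl hE
      obtain ⟨f, hf, hr⟩ := exists_injective_range_eq hE
      exact Or.inr ⟨f, hf, hr, eq_univ_of_forall fun A => mem_E (hr ▸ image_subset_range f A)⟩
    have hO : RestrictsInto {finIdeal} (sum2 univ finIdeal) O := by
      by_cases hO : O.Finite
      · exact Or.inl hO
      obtain ⟨f, hf, hr⟩ := exists_injective_range_eq hO
      refine Or.inr ⟨f, hf, hr, ?_⟩
      ext A
      exact (mem_O (hr ▸ image_subset_range f A)).trans (finite_image_iff hf.injOn)
    rw [hEO]
    by_cases hOf : O.Finite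
    · refine (hE.union_finite hfr hOf).imp_right ?_
      exact fun ⟨f, hf, hr, h⟩ => ⟨f, hf, hr, Or.inl h⟩
    by_cases hEf : E.Finite
    · rw [union_comm]
      refine (hO.union_finite hfr hEf).imp_right ?_
      exact fun ⟨f, hf, hr, h⟩ => ⟨f, hf, hr, Or.inr (Or.inl h)⟩
    obtain ⟨f, hf, hfr'⟩ := exists_injective_range_eq hEf
    obtain ⟨g, hg, hgr⟩ := exists_injective_range_eq hOf
    let h : ℕ → ℕ := fun x => if Even x then f (x / 2) else g (x / 2)
    have h_even (m : ℕ) : h (2 * m) = f m := by simp [h]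
    have h_odd (m : ℕ) : h (2 * m + 1) = g m := by
      simp only [h, if_neg (Nat.not_even_two_mul_add_one m)]
      congr 1
      omega
    have hcases (x : ℕ) : (∃ m, x = 2 * m) ∨ ∃ m, x = 2 * m + 1 := by
      rcases Nat.even_or_odd' x with ⟨m, h | h⟩
      exacts [Or.inl ⟨m, h⟩, Or.inr ⟨m, h⟩]
    have hfE (m : ℕ) : f m ∈ E := hfr' ▸ mem_range_self m
    have hgO (m : ℕ) : g m ∈ O := hgr ▸ mem_range_self m
    have hfg (a b : ℕ) : f a ≠ g b := fun hab => hd (hfE a) (hab ▸ (hgO b).2)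
    have hh : Function.Injective h := by
      intro x y hxy
      obtain ⟨m, rfl⟩ | ⟨m, rfl⟩ := hcases x <;> obtain ⟨n, rfl⟩ | ⟨n, rfl⟩ := hcases y <;>
        simp only [h_even, h_odd] at hxy
      · rw [hf hxy]
      · exact absurd hxy (hfg m n)
      · exact absurd hxy.symm (hfg n m)
      · rw [hg hxy]
    refine Or.inr ⟨h, hh, ?_, Or.inr (Or.inr ?_)⟩
    · rw [← hfr', ← hgr]
      refine Subset.antisymm ?_ (union_subset ?_ ?_)
      · rintro _ ⟨x, rfl⟩
        obtain ⟨m, rfl⟩ | ⟨m, rfl⟩ := hcases x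
        · exact Or.inl ⟨m, (h_even m).symm⟩
        · exact Or.inr ⟨m, (h_odd m).symm⟩
      · exact range_subset_iff.2 fun m => ⟨_, h_even m⟩
      · exact range_subset_iff.2 fun m => ⟨_, h_odd m⟩
    · ext A
      have key : h '' A ∩ range (fun m => 2 * m + 1) = g '' {m | 2 * m + 1 ∈ A} := by
        refine Eq.trans ?_ (image_preimage_eq_image_inter_range hh h_odd A).symm
        rw [hgr]
        ext x
        refine ⟨fun hx => ⟨hx.1, ?_⟩, fun hx => ⟨hx.1, hx.2.2⟩⟩
        obtain ⟨⟨a, -, rfl⟩, hx⟩ := hx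
        obtain ⟨m, rfl⟩ | ⟨m, rfl⟩ := hcases a
        · rw [h_even] at hx
          exact absurd hx (hd (hfE m))
        · exact h_odd m ▸ hgO m
      change h '' A ∈ sum2 univ finIdeal ↔ _
      rw [mem_sum2_univ_finIdeal, key, finite_image_iff hg.injOn]
      exact ⟨fun hA => ⟨trivial, hA⟩, fun hA => hA.2⟩

theorem Bfam_mono {ξ α : Ordinal.{0}} (h : ξ < α) : Bfam ξ ⊆ Bfam α := by
  have hα : α ≠ 0 := (bot_le.trans_lt h).ne'
  rw [Bfam_of_ne_zero hα]
  by_cases hξ : ξ = 0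
  · subst hξ
    exact Bfam_zero_subset_BstepOf ⟨0, h, by simp [Bfam_zero]⟩
  · rw [Bfam_of_ne_zero hξ]
    exact BstepOf_mono fun I ⟨η, hη, hI⟩ => ⟨η, hη.trans h, hI⟩

theorem restrictsInto_Bfam {α : Ordinal.{0}} {I : Set (Set ℕ)} (hI : I ∈ Bfam α) (K : Set ℕ) :
    RestrictsInto (Bfam α) I K := by
  induction α using WellFoundedLT.induction generalizing I K with
  | ind α ih =>
    by_cases hα : α = 0
    · subst hα
      exact restrictsInto_Bfam_zero hI K
    · rw [Bfam_of_ne_zero hα] at hI ⊢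
      refine restrictsInto_BstepOf ?_ ?_ ?_ ?_ hI K
      · rintro J ⟨ξ, -, hJ⟩
        exact isFrechet_of_mem_Bfam hJ
      · rintro J ⟨ξ, hξ, hJ⟩ L
        exact (ih ξ hξ hJ L).imp_right fun ⟨f, hf, hr, h⟩ => ⟨f, hf, hr, ξ, hξ, h⟩
      · rintro J ⟨ξ, hξ, hJ⟩
        rw [← Bfam_of_ne_zero hα]
        exact Bfam_mono hξ hJ
      · rw [← Bfam_of_ne_zero hα]
        exact Bfam_mono (bot_lt_iff_ne_bot.2 hα) (by simp [Bfam_zero])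

end Hierarchy

/-- Lemma 3.5: `ℬ` is closed under restrictions: if `I ∈ ℬ_α` and `K ⊆ ℕ` is
infinite, then `I ↾ K` is isomorphic to an ideal in `ℬ_α`. -/
theorem stmt3 (α : Ordinal.{0}) (hα : α < omega1)
    (I : Set (Set ℕ)) (hI : I ∈ Bfam α) (K : Set ℕ) (hK : K.Infinite) :
    ∃ J ∈ Bfam α, IdealIso (restrictIdeal I K) J := by
  obtain ⟨f, hf, rfl, hB⟩ := (restrictsInto_Bfam hI K).resolve_left hK
  refine ⟨_, hB, (Equiv.ofInjective f hf).symm, fun A => ?_⟩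
  have : f '' ((Equiv.ofInjective f hf).symm '' A) = Subtype.val '' A := by
    rw [image_image]
    exact image_congr fun x _ => Equiv.apply_ofInjective_symm hf x
  change _ ↔ f '' _ ∈ I
  rw [this]
  rfl
end

section
/- If (Iₙ)ₙ is a sequence of ideals such that each Iₙ is Fréchet, then the countable direct sum ⊕ₙ Iₙ is Fréchet. -/
open Set

/-- Lemma 2.3: a countable direct sum of Fréchet ideals is Fréchet. Here
`{Kₙ : n ∈ ℕ}` is a partition of the countable set `X`, `Iₙ` is an ideal on `Kₙ`
and the direct sum is `{A ⊆ X : A ∩ Kₙ ∈ Iₙ for all n}`. -/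
theorem stmt6 {X : Type*} [Countable X] (K : ℕ → Set X)
    (hdisj : ∀ m n, m ≠ n → Disjoint (K m) (K n)) (hcover : (⋃ n, K n) = Set.univ)
    (I : ∀ n, Set (Set ↥(K n))) (hid : ∀ n, IsIdealOn (I n))
    (hF : ∀ n, IsFrechet (I n)) :
    IsFrechet {A : Set X | ∀ n, (Subtype.val ⁻¹' A : Set ↥(K n)) ∈ I n} := by
  ext A
  constructor
  · intro hA n
    rw [← hF n]
    intro B hB
    have hBS : (Subtype.val '' B : Set X) ∈
        orth {A : Set X | ∀ n, (Subtype.val ⁻¹' A : Set ↥(K n)) ∈ I n} := by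
      intro C hC
      have hfin := (hB _ (hC n)).image Subtype.val
      rwa [Set.image_preimage_inter] at hfin
    have hfin := hA _ hBS
    rw [← Set.image_inter_preimage] at hfin
    exact hfin.of_finite_image Subtype.val_injective.injOn
  · intro hA B hB
    rw [Set.inter_comm]
    exact hB A hA
end

section
/- Every member of ℬ is isomorphic to a restriction I_wf↾A for some A ⊆ ℕ^{<ω}, and also to a restriction I_d↾B for some B ⊆ ℕ^{<ω}. In particular, every member of ℬ is F_σδ. -/
open Set

open Filter

/-- Membership in `Iwf` in terms of the entries of the sequences. -/
lemma mem_Iwf_iff {A : Set (List ℕ)} :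
    A ∈ Iwf ↔ ¬ ∃ α : ℕ → ℕ, ∀ n, ∃ a ∈ A, ∀ i < n, a[i]? = some (α i) := by
  have key : ∀ (α : ℕ → ℕ) (n : ℕ) (a : List ℕ),
      (List.ofFn fun i : Fin n => α i) <+: a ↔ ∀ i < n, a[i]? = some (α i) := by
    intro α n a
    rw [List.prefix_iff_getElem?]
    simp [List.getElem_ofFn]
  simp only [Iwf, genTree, Set.mem_ofPred_eq, key]

/-- A set is dominated iff at each position its entries are bounded. -/
lemma mem_Idom_iff {A : Set (List ℕ)} :
    A ∈ Idom ↔ ∀ i : ℕ, ∃ b, ∀ s ∈ A, ∀ v, s[i]? = some v → v ≤ b := by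
  constructor
  · rintro ⟨α, hα⟩ i
    refine ⟨α i, fun s hs v hv => ?_⟩
    obtain ⟨hi, rfl⟩ := List.getElem?_eq_some_iff.1 hv
    exact hα s hs ⟨i, hi⟩
  · intro h
    choose α hα using h
    exact ⟨α, fun s hs i => hα i s hs _ (by simp)⟩

lemma Iwf_mono {A B : Set (List ℕ)} (hA : A ∈ Iwf) (hBA : B ⊆ A) : B ∈ Iwf := by
  rw [mem_Iwf_iff] at *
  rintro ⟨α, hα⟩
  refine hA ⟨α, fun n => ?_⟩
  obtain ⟨a, ha, h⟩ := hα n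
  exact ⟨a, hBA ha, h⟩

lemma Idom_mono {A B : Set (List ℕ)} (hA : A ∈ Idom) (hBA : B ⊆ A) : B ∈ Idom := by
  obtain ⟨α, hα⟩ := hA
  exact ⟨α, fun s hs => hα s (hBA hs)⟩

/-- König's lemma: an infinite dominated set is not well founded. -/
lemma not_mem_Iwf_of_infinite {C : Set (List ℕ)} (hC : C.Infinite) (hd : C ∈ Idom) :
    C ∉ Iwf := by
  rw [mem_Idom_iff] at hd
  rw [mem_Iwf_iff, not_not]
  have : (cofinite ⊓ 𝓟 C).NeBot := hC.cofinite_inf_principal_neBot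
  let U : Ultrafilter (List ℕ) := Ultrafilter.of (cofinite ⊓ 𝓟 C)
  have hU : (U : Filter (List ℕ)) ≤ cofinite ⊓ 𝓟 C := Ultrafilter.of_le _
  have hUC : ∀ᶠ s in (U : Filter (List ℕ)), s ∈ C := hU.trans inf_le_right (mem_principal_self C)
  have hw : ∀ i : ℕ, ∃ w : Option ℕ, ∀ᶠ s in (U : Filter (List ℕ)), s[i]? = w := by
    intro i
    obtain ⟨b, hb⟩ := hd i
    have hfin : (insert none (some '' Set.Iic b) : Set (Option ℕ)).Finite :=
      ((Set.finite_Iic b).image _).insert _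
    have hmem : (insert none (some '' Set.Iic b) : Set (Option ℕ)) ∈ U.map (fun s => s[i]?) := by
      rw [Ultrafilter.mem_map]
      filter_upwards [hUC] with s hs
      cases h : s[i]? with
      | none => simp [h]
      | some v => simpa [h] using hb s hs v h
    obtain ⟨w, -, hw⟩ := Ultrafilter.eq_pure_of_finite_mem hfin hmem
    refine ⟨w, ?_⟩
    have : {w} ∈ U.map (fun s => s[i]?) := by rw [hw]; simp
    exact this
  choose w hw using hw
  have hlt : ∀ n, ∀ᶠ s in (U : Filter (List ℕ)), ∀ i < n, s[i]? = w i := fun n =>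
    (eventually_all_finite (Set.finite_lt_nat n)).2 fun i _ => hw i
  have hsome : ∀ i, ∃ v, w i = some v := by
    intro i
    rw [← Option.ne_none_iff_exists']
    intro hi
    obtain ⟨s₀, hs₀⟩ := (hlt (i + 1)).exists
    have hne : ∀ᶠ s in (U : Filter (List ℕ)), s ≠ s₀ :=
      hU.trans inf_le_left (Set.finite_singleton s₀).compl_mem_cofinite
    obtain ⟨s, hs, hss⟩ := ((hlt (i + 1)).and hne).exists
    refine hss (List.ext_getElem? fun j => ?_)
    rcases Nat.lt_or_ge j (i + 1) with hj | hj
    · rw [hs j hj, hs₀ j hj]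
    · have h1 := hs i (by omega)
      have h2 := hs₀ i (by omega)
      rw [hi, List.getElem?_eq_none_iff] at h1 h2
      rw [List.getElem?_eq_none (by omega), List.getElem?_eq_none (by omega)]
  choose α hα using hsome
  refine ⟨α, fun n => ?_⟩
  obtain ⟨s, hs, hsC⟩ := ((hlt n).and hUC).exists
  exact ⟨s, hsC, fun i hi => by rw [hs i hi, hα]⟩

lemma finite_inter_of_Iwf_of_Idom {A B : Set (List ℕ)} (hA : A ∈ Iwf) (hB : B ∈ Idom) :
    (A ∩ B).Finite := by
  by_contra h
  exact not_mem_Iwf_of_infinite h (Idom_mono hB inter_subset_right)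
    (Iwf_mono hA inter_subset_left)

lemma orth_Iwf : orth Iwf = Idom := by
  refine Set.Subset.antisymm (fun B hB => ?_) fun B hB A hA => finite_inter_of_Iwf_of_Idom hA hB
  rw [mem_Idom_iff]
  by_contra! h
  obtain ⟨i, hi⟩ := h
  let V : Set ℕ := {v | ∃ s ∈ B, s[i]? = some v}
  have hV : V.Infinite := Set.infinite_of_forall_exists_gt fun b => by
    obtain ⟨s, hs, v, hv, hbv⟩ := hi b
    exact ⟨v, ⟨s, hs, hv⟩, hbv⟩
  have hs : ∀ v : V, ∃ s ∈ B, s[i]? = some v.1 := fun v => v.2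
  choose s hsB hs using hs
  have hwf : Set.range s ∈ Iwf := by
    rw [mem_Iwf_iff]
    rintro ⟨α, hα⟩
    obtain ⟨_, ⟨v, rfl⟩, hv⟩ := hα (i + 1)
    obtain ⟨_, ⟨u, rfl⟩, hu⟩ := hα (max (i + 1) ((s v).length + 1))
    have hvi := hv i (by omega)
    have hui := hu i (by omega)
    rw [hs] at hvi hui
    obtain rfl : u = v := Subtype.ext (Option.some_injective _ (hui.trans hvi.symm))
    have := hu (s u).length (by omega)
    simp at this
  have hinj : Function.Injective s := fun u v huv =>
    Subtype.ext (Option.some_injective _ (by rw [← hs, ← hs, huv]))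
  have hfin := hB _ hwf
  rw [inter_eq_left.2 (Set.range_subset_iff.2 hsB)] at hfin
  have := hV.to_subtype
  exact Set.infinite_range_of_injective hinj hfin

lemma orth_Idom : orth Idom = Iwf := by
  refine Set.Subset.antisymm (fun B hB => ?_) fun B hB A hA => ?_
  · rw [mem_Iwf_iff]
    rintro ⟨α, hα⟩
    choose a haB ha using hα
    have hlen : ∀ n, n ≤ (a n).length := by
      intro n
      by_contra! h
      have := ha n _ h
      simp at this
    have hd : Set.range a ∈ Idom := by
      rw [mem_Idom_iff]
      intro i
      refine ⟨α i + ∑ n ∈ Finset.range (i + 1), (a n)[i]?.getD 0, ?_⟩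
      rintro _ ⟨n, rfl⟩ v hv
      rcases Nat.lt_or_ge i n with hn | hn
      · rw [ha n i hn] at hv
        cases hv
        exact Nat.le_add_right _ _
      · have := Finset.single_le_sum (f := fun n => (a n)[i]?.getD 0) (fun _ _ => Nat.zero_le _)
          (Finset.mem_range.2 (show n < i + 1 by omega))
        simp only [hv, Option.getD_some] at this
        omega
    have hfin := hB _ hd
    rw [inter_eq_left.2 (Set.range_subset_iff.2 haB)] at hfin
    obtain ⟨b, hb⟩ := (hfin.image List.length).bddAbove
    have := hb ⟨_, ⟨b + 1, rfl⟩, rfl⟩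
    have := hlen (b + 1)
    omega
  · rw [inter_comm]
    exact finite_inter_of_Iwf_of_Idom hB hA

/-- An embedding of `I` into a downward closed family also embeds the orthogonals. -/
lemma IdealEmbeds.orth {X Y : Type*} {I : Set (Set X)} {J : Set (Set Y)}
    (hJ : ∀ A ∈ J, ∀ B ⊆ A, B ∈ J) (h : IdealEmbeds I J) : IdealEmbeds (orth I) (orth J) := by
  obtain ⟨f, hf, hIJ⟩ := h
  refine ⟨f, hf, fun B => ⟨fun hB C hC => ?_, fun hB A hA => ?_⟩⟩
  · have hA : f ⁻¹' C ∈ I := (hIJ _).2 (hJ C hC _ (image_preimage_subset f C))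
    rw [inter_comm, ← image_inter_preimage, inter_comm]
    exact (hB _ hA).image f
  · have := hB _ ((hIJ A).1 hA)
    rw [← image_inter hf] at this
    exact this.of_finite_image hf.injOn

lemma IdealEmbeds.iso_restrict {X Y : Type*} {I : Set (Set X)} {J : Set (Set Y)}
    (h : IdealEmbeds I J) : ∃ K : Set Y, IdealIso I (restrictIdeal J K) := by
  obtain ⟨f, hf, hIJ⟩ := h
  refine ⟨Set.range f, Equiv.ofInjective f hf, fun A => ?_⟩
  rw [hIJ A, restrictIdeal, Set.mem_ofPred_eq, Set.image_image]
  simp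

/-- The direct sum of the `I n`, where `e x = (n, m)` says that the `x`-th point is the `m`-th
point of the `n`-th block. -/
def sumAlong (e : ℕ → ℕ × ℕ) (I : ℕ → Set (Set ℕ)) : Set (Set ℕ) :=
  {A | ∀ n, {m | ∃ x ∈ A, e x = (n, m)} ∈ I n}

lemma IdealEmbeds.sumAlong_Iwf {e : ℕ → ℕ × ℕ} (he : Function.Injective e)
    {I : ℕ → Set (Set ℕ)} (h : ∀ n, IdealEmbeds (I n) Iwf) : IdealEmbeds (sumAlong e I) Iwf := by
  choose f hf hI using h
  refine ⟨fun x => (e x).1 :: f (e x).1 (e x).2, fun x y hxy => ?_, fun A => ?_⟩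
  · obtain ⟨h1, h2⟩ := List.cons.inj hxy
    rw [h1] at h2
    exact he (Prod.ext h1 (hf _ h2))
  simp only [sumAlong, Set.mem_ofPred_eq, hI, mem_Iwf_iff]
  rw [← not_exists, not_iff_not]
  constructor
  · rintro ⟨n, α, hα⟩
    refine ⟨fun i => Nat.casesOn i n α, fun k => ?_⟩
    obtain ⟨_, ⟨m, ⟨x, hx, hxe⟩, rfl⟩, ha⟩ := hα k
    refine ⟨_, ⟨x, hx, rfl⟩, fun i hi => ?_⟩
    cases i with
    | zero => simp [hxe]
    | succ i => simpa [hxe] using ha i (by omega)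
  · rintro ⟨α, hα⟩
    refine ⟨α 0, fun i => α (i + 1), fun k => ?_⟩
    obtain ⟨_, ⟨x, hx, rfl⟩, ha⟩ := hα (k + 1)
    have h0 : (e x).1 = α 0 := by simpa using ha 0 (by omega)
    refine ⟨_, ⟨(e x).2, ⟨x, hx, Prod.ext h0 rfl⟩, rfl⟩, fun i hi => ?_⟩
    simpa [h0] using ha (i + 1) (by omega)

lemma IdealEmbeds.sumAlong_Idom {e : ℕ → ℕ × ℕ} (he : Function.Injective e)
    {I : ℕ → Set (Set ℕ)} (h : ∀ n, IdealEmbeds (I n) Idom) : IdealEmbeds (sumAlong e I) Idom := by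
  choose f hf hI using h
  let g : ℕ → List ℕ → List ℕ := fun n s => List.replicate n 0 ++ 1 :: s
  have glt : ∀ n s i, i < n → (g n s)[i]? = some 0 := fun n s i hi => by
    simp only [g]
    rw [List.getElem?_append_left (by simpa using hi)]
    simp [hi]
  have geq : ∀ n s, (g n s)[n]? = some 1 := fun n s => by simp [g]
  have ggt : ∀ n s i, (g n s)[n + 1 + i]? = s[i]? := fun n s i => by
    simp only [g]
    rw [List.getElem?_append_right (by simp; omega)]
    simp [show n + 1 + i - n = i + 1 by omega]
  refine ⟨fun x => g (e x).1 (f (e x).1 (e x).2), fun x y hxy => ?_, fun A => ?_⟩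
  · have hxy : g _ _ = g _ _ := hxy
    have h1 : (e x).1 = (e y).1 := by
      by_contra hne
      rcases Nat.lt_or_gt_of_ne hne with hlt | hlt
      · have := geq (e x).1 (f (e x).1 (e x).2)
        rw [hxy, glt _ _ _ hlt] at this
        simp at this
      · have := geq (e y).1 (f (e y).1 (e y).2)
        rw [← hxy, glt _ _ _ hlt] at this
        simp at this
    rw [h1] at hxy
    have h2 := (List.cons.inj (List.append_cancel_left hxy)).2
    exact he (Prod.ext h1 (hf _ h2))
  simp only [sumAlong, Set.mem_ofPred_eq, hI, mem_Idom_iff]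
  constructor
  · intro hA
    choose b hb using hA
    intro j
    refine ⟨1 + ∑ n ∈ Finset.range j, b n (j - n - 1), ?_⟩
    rintro _ ⟨x, hx, rfl⟩ v hv
    rcases Nat.lt_trichotomy j (e x).1 with hj | hj | hj
    · rw [glt _ _ _ hj] at hv
      cases hv
      exact Nat.zero_le _
    · rw [hj, geq] at hv
      cases hv
      exact Nat.le_add_right _ _
    · have hv' := hv
      rw [show j = (e x).1 + 1 + (j - (e x).1 - 1) by omega, ggt] at hv'
      have h1 := hb (e x).1 (j - (e x).1 - 1) _ ⟨(e x).2, ⟨x, hx, rfl⟩, rfl⟩ v hv'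
      have h2 := Finset.single_le_sum (f := fun n => b n (j - n - 1)) (fun _ _ => Nat.zero_le _)
          (Finset.mem_range.2 hj)
      omega
  · intro hA n i
    obtain ⟨b, hb⟩ := hA (n + 1 + i)
    refine ⟨b, ?_⟩
    rintro _ ⟨m, ⟨x, hx, hxe⟩, rfl⟩ v hv
    refine hb _ ⟨x, hx, rfl⟩ v ?_
    simp only [hxe]
    rwa [ggt]

/-- `I` is isomorphic to restrictions of both `Iwf` and `Idom`. -/
def EmbedsBoth (I : Set (Set ℕ)) : Prop := IdealEmbeds I Iwf ∧ IdealEmbeds I Idom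

lemma EmbedsBoth.orth {I : Set (Set ℕ)} (h : EmbedsBoth I) : EmbedsBoth (orth I) := by
  have h1 := h.2.orth fun A hA B hBA => Idom_mono hA hBA
  have h2 := h.1.orth fun A hA B hBA => Iwf_mono hA hBA
  rw [orth_Idom] at h1
  rw [orth_Iwf] at h2
  exact ⟨h1, h2⟩

lemma EmbedsBoth.sumAlong {e : ℕ → ℕ × ℕ} (he : Function.Injective e)
    {I : ℕ → Set (Set ℕ)} (h : ∀ n, EmbedsBoth (I n)) : EmbedsBoth (sumAlong e I) :=
  ⟨IdealEmbeds.sumAlong_Iwf he fun n => (h n).1, IdealEmbeds.sumAlong_Idom he fun n => (h n).2⟩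

lemma EmbedsBoth.empty_mem {I : Set (Set ℕ)} (h : EmbedsBoth I) : ∅ ∈ I := by
  obtain ⟨f, -, hI⟩ := h.2
  rw [hI, image_empty]
  exact ⟨0, by simp⟩

lemma EmbedsBoth.directSumN {I : ℕ → Set (Set ℕ)} (h : ∀ n, EmbedsBoth (I n)) :
    EmbedsBoth (directSumN I) := by
  have : _root_.directSumN I = _root_.sumAlong Nat.unpair I := by
    ext A
    refine forall_congr' fun n => iff_of_eq (congrArg (· ∈ I n) ?_)
    ext m
    constructor
    · exact fun hm => ⟨_, hm, Nat.unpair_pair n m⟩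
    · rintro ⟨x, hx, hxe⟩
      have := Nat.pair_unpair x
      rw [hxe] at this
      simpa [this] using hx
  rw [this]
  exact EmbedsBoth.sumAlong Nat.pairEquiv.symm.injective h

lemma EmbedsBoth.finSumN {k : ℕ} {I : ℕ → Set (Set ℕ)} (h : ∀ i ≤ k, EmbedsBoth (I i)) :
    EmbedsBoth (finSumN k I) := by
  let e : ℕ → ℕ × ℕ := fun x => (x % (k + 1), x / (k + 1))
  have hdiv : ∀ x, x / (k + 1) * (k + 1) + x % (k + 1) = x := fun x => Nat.div_add_mod' x (k + 1)
  have he : Function.Injective e := fun x y hxy => by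
    obtain ⟨h1, h2⟩ := Prod.mk.inj hxy
    rw [← hdiv x, ← hdiv y, h1, h2]
  have hI' : ∀ n, EmbedsBoth (I (min n k)) := fun n => h _ (min_le_right n k)
  have : _root_.finSumN k I = _root_.sumAlong e fun n => I (min n k) := by
    ext A
    have hblock : ∀ i ≤ k, {m | m * (k + 1) + i ∈ A} = {m | ∃ x ∈ A, e x = (i, m)} := by
      intro i hi
      ext m
      constructor
      · refine fun hm => ⟨_, hm, Prod.ext ?_ ?_⟩
        · show (m * (k + 1) + i) % (k + 1) = i
          rw [Nat.mul_add_mod', Nat.mod_eq_of_lt (by omega)]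
        · show (m * (k + 1) + i) / (k + 1) = m
          rw [Nat.mul_comm, Nat.mul_add_div (by omega), Nat.div_eq_of_lt (by omega), add_zero]
      · rintro ⟨x, hx, hxe⟩
        obtain ⟨rfl, rfl⟩ := Prod.mk.inj hxe
        simpa [hdiv] using hx
    constructor
    · intro hA n
      rcases le_or_gt n k with hn | hn
      · rw [← hblock n hn]
        simpa [min_eq_left hn] using hA n hn
      · convert (hI' n).empty_mem
        refine eq_empty_of_forall_notMem ?_
        rintro m ⟨x, -, hxe⟩
        have := (Prod.mk.inj hxe).1
        have := Nat.mod_lt x (by omega : k + 1 > 0)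
        omega
    · intro hA i hi
      rw [hblock i hi]
      simpa [min_eq_left hi] using hA i
  rw [this]
  exact EmbedsBoth.sumAlong he hI'

lemma embedsBoth_univ : EmbedsBoth Set.univ := by
  constructor
  · refine ⟨fun n => [n], fun m n h => by simpa using h, fun A => ?_⟩
    simp only [Set.mem_univ, true_iff, mem_Iwf_iff]
    rintro ⟨α, hα⟩
    obtain ⟨_, ⟨n, -, rfl⟩, hn⟩ := hα 2
    simpa using hn 1 (by omega)
  · refine ⟨fun n => List.replicate n 0, fun m n h => by simpa using congrArg List.length h,
      fun A => ?_⟩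
    simp only [Set.mem_univ, true_iff]
    refine ⟨0, ?_⟩
    rintro _ ⟨n, -, rfl⟩ i
    simp

lemma embedsBoth_finIdeal : EmbedsBoth finIdeal := by
  have : finIdeal = orth Set.univ := by
    ext A
    refine ⟨fun hA B _ => Set.Finite.subset hA inter_subset_right, fun hA => ?_⟩
    simpa [finIdeal] using hA Set.univ trivial
  rw [this]
  exact embedsBoth_univ.orth

lemma EmbedsBoth.sum2 {I J : Set (Set ℕ)} (hI : EmbedsBoth I) (hJ : EmbedsBoth J) :
    EmbedsBoth (sum2 I J) := by
  have : _root_.sum2 I J = _root_.finSumN 1 fun i => if i = 0 then I else J := by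
    ext A
    constructor
    · rintro ⟨h0, h1⟩ i hi
      interval_cases i
      · simpa [mul_comm] using h0
      · simpa [mul_comm] using h1
    · intro h
      exact ⟨by simpa [mul_comm] using h 0 (by omega), by simpa [mul_comm] using h 1 le_rfl⟩
  rw [this]
  refine EmbedsBoth.finSumN fun i _ => ?_
  split_ifs
  · exact hI
  · exact hJ

lemma EmbedsBoth.of_mem_BstepOf {U : Set (Set (Set ℕ))} (hU : ∀ I ∈ U, EmbedsBoth I)
    {J : Set (Set ℕ)} (hJ : J ∈ BstepOf U) : EmbedsBoth J := by
  obtain ⟨k, I, hI, rfl⟩ := hJ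
  refine EmbedsBoth.finSumN fun i hi => ?_
  rcases hI i hi with ⟨K, hK, h⟩ | ⟨_, ⟨K, hK, rfl⟩, h⟩
  · rw [h]
    exact EmbedsBoth.directSumN fun n => hU _ (hK n)
  · rw [h]
    exact (EmbedsBoth.directSumN fun n => hU _ (hK n)).orth

lemma embedsBoth_of_mem_Bfam (α : Ordinal.{0}) : ∀ I ∈ Bfam α, EmbedsBoth I := by
  induction α using WellFoundedLT.induction with
  | ind α ih =>
    intro I hI
    rw [Bfam, WellFounded.fix_eq] at hI
    split_ifs at hI
    · rcases hI with rfl | rfl | rfl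
      · exact embedsBoth_univ
      · exact embedsBoth_finIdeal
      · exact embedsBoth_univ.sum2 embedsBoth_finIdeal
    · refine EmbedsBoth.of_mem_BstepOf ?_ hI
      rintro J ⟨ξ, hξ, hJ⟩
      exact ih ξ hξ J hJ

lemma IdealEmbeds.isFsd {X : Type*} {I : Set (Set X)} (h : IdealEmbeds I Idom) :
    IsFsd (idealSet I) := by
  obtain ⟨f, -, hI⟩ := h
  refine ⟨fun i b => {g | ∀ x, g x = true → ∀ v, (f x)[i]? = some v → v ≤ b}, fun i b => ?_, ?_⟩
  · beta_reduce
    rw [Set.ofPred_forall]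
    refine isClosed_iInter fun x => ?_
    have hx : Continuous fun g : X → Bool => g x := continuous_apply x
    exact (isClosed_discrete {c : Bool | c = true → ∀ v, (f x)[i]? = some v → v ≤ b}).preimage hx
  · ext g
    simp only [idealSet, Set.mem_ofPred_eq, hI, mem_Idom_iff, Set.mem_iInter, Set.mem_iUnion,
      Set.forall_mem_image]

/-- Theorem 4.1: every member of `ℬ` is isomorphic to a restriction of `I_wf`
and also to a restriction of `I_d`; in particular every member of `ℬ` is `F_σδ`. -/
theorem stmt8 (α : Ordinal.{0}) (hα : α < omega1)
    (I : Set (Set ℕ)) (hI : I ∈ Bfam α) :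
    (∃ A : Set (List ℕ), IdealIso I (restrictIdeal Iwf A)) ∧
    (∃ B : Set (List ℕ), IdealIso I (restrictIdeal Idom B)) ∧
    IsFsd (idealSet I) := by
  have h := embedsBoth_of_mem_Bfam α I hI
  exact ⟨h.1.iso_restrict, h.2.iso_restrict, h.2.isFsd⟩
end

section
/- Let A ⊆ ℕ^{<ω} and let T = ⟨A⟩ be the tree generated by A. If I_wf ↪ I_wf↾T, then I_wf ↪ I_wf↾A. -/
open Set

/-- A countable family of infinite sets has an injective choice function. -/
lemma exists_injective_mem_of_infinite {ι X : Type*} [Encodable ι] (C : ι → Set X)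
    (hC : ∀ i, (C i).Infinite) : ∃ h : ι → X, Function.Injective h ∧ ∀ i, h i ∈ C i := by
  classical
  choose F hFC hFcard using fun i => (hC i).exists_subset_card_eq (Encodable.encode i + 1)
  obtain ⟨h, hinj, hmem⟩ :=
    (Finset.all_card_le_biUnion_card_iff_exists_injective F).1 fun S => by
      rcases S.eq_empty_or_nonempty with rfl | hS
      · simp
      obtain ⟨i, hi, hmax⟩ := S.exists_max_image Encodable.encode hS
      calc S.card ≤ (Finset.range (Encodable.encode i + 1)).card :=
            Finset.card_le_card_of_injOn Encodable.encode
              (fun j hj => by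
                have := hmax j hj
                simp only [Finset.coe_range, Set.mem_Iio]
                omega)
              Encodable.encode_injective.injOn
        _ = (F i).card := by rw [hFcard, Finset.card_range]
        _ ≤ (S.biUnion F).card := Finset.card_le_card (Finset.subset_biUnion_of_mem F hi)
  exact ⟨h, hinj, fun i => hFC i (hmem i)⟩

lemma ofFn_prefix_ofFn (α : ℕ → ℕ) {m n : ℕ} (hmn : m ≤ n) :
    (List.ofFn fun i : Fin m => α i) <+: List.ofFn fun i : Fin n => α i := by
  rw [List.prefix_iff_eq_take]
  apply List.ext_getElem <;> simp [hmn]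

lemma finite_setOf_prefix (l : List ℕ) : {t : List ℕ | t <+: l}.Finite :=
  (List.finite_toSet l.inits).subset fun t ht => by simpa using ht

/-- Replacing the members of a one-to-one family of sequences by extensions does not affect
membership in `Iwf`. -/
lemma image_mem_Iwf_iff_of_prefix {ι : Type*} {u v : ι → List ℕ} (hu : Function.Injective u)
    (huv : ∀ i, u i <+: v i) (B : Set ι) : u '' B ∈ Iwf ↔ v '' B ∈ Iwf := by
  refine not_congr (exists_congr fun α => ⟨fun h n => ?_, fun h m => ?_⟩)
  · obtain ⟨_, ⟨i, hi, rfl⟩, hn⟩ := h n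
    exact ⟨v i, ⟨i, hi, rfl⟩, hn.trans (huv i)⟩
  · by_contra hm
    have hfin : {i | u i <+: List.ofFn fun i : Fin m => α i}.Finite :=
      Set.Finite.preimage (f := u) hu.injOn (finite_setOf_prefix _)
    obtain ⟨N, hN⟩ := (hfin.image fun i => (v i).length).bddAbove
    obtain ⟨_, ⟨i, hi, rfl⟩, hn⟩ := h (N + m + 1)
    have hmv := (ofFn_prefix_ofFn α (by omega : m ≤ N + m + 1)).trans hn
    rcases List.prefix_or_prefix_of_prefix hmv (huv i) with hp | hp
    · exact hm ⟨u i, ⟨i, hi, rfl⟩, hp⟩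
    · have hle : (v i).length ≤ N := hN ⟨i, hp, rfl⟩
      have hlen := hn.length_le
      rw [List.length_ofFn] at hlen
      omega

lemma infinite_Nbhd (s : List ℕ) : (Nbhd s).Infinite :=
  (Set.infinite_range_of_injective
    ((List.append_right_injective s).comp (List.singleton_injective (α := ℕ)))).mono <| by
    rintro _ ⟨n, rfl⟩
    exact List.prefix_append s [n]

/-- Lemma 5.3: if `T = ⟨A⟩` is the tree generated by `A ⊆ ℕ^{<ω}` and
`I_wf ↪ I_wf ↾ T`, then `I_wf ↪ I_wf ↾ A`. -/
theorem stmt11 (A : Set (List ℕ))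
    (h : IdealEmbeds Iwf (restrictIdeal Iwf (genTree A))) :
    IdealEmbeds Iwf (restrictIdeal Iwf A) := by
  obtain ⟨f, hf, hfI⟩ := h
  have hex : ∀ t : genTree A, ∃ a : A, t.1 <+: a.1 := fun t =>
    let ⟨a, ha, hta⟩ := t.2
    ⟨⟨a, ha⟩, hta⟩
  choose a ha using hex
  have hfv : Function.Injective fun s => (f s).1 := Subtype.val_injective.comp hf
  have hfiber : ∀ x : A, {t | a (f t) = x}.Finite := fun x =>
    ((finite_setOf_prefix x.1).preimage hfv.injOn).subset fun t ht => by
      have hp := ha (f t)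
      rw [show a (f t) = x from ht] at hp
      exact hp
  have hC : ∀ s, ((fun t => a (f t)) '' Nbhd s).Infinite := fun s hfin =>
    infinite_Nbhd s <| (hfin.biUnion fun x _ => hfiber x).subset fun t ht =>
      Set.mem_biUnion (Set.mem_image_of_mem (fun t => a (f t)) ht) rfl
  obtain ⟨g, hg, hgC⟩ := exists_injective_mem_of_infinite _ hC
  choose e he hge using hgC
  refine ⟨g, hg, fun B => ?_⟩
  have hB : Subtype.val '' (g '' B) = (fun t => (a (f t)).1) '' (e '' B) := by
    simp only [Set.image_image, ← hge]
  have hids := image_mem_Iwf_iff_of_prefix (u := id) (v := e) Function.injective_id he B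
  rw [Set.image_id] at hids
  rw [hids, hfI]
  change Subtype.val '' (f '' (e '' B)) ∈ Iwf ↔ Subtype.val '' (g '' B) ∈ Iwf
  rw [hB, Set.image_image Subtype.val f]
  exact image_mem_Iwf_iff_of_prefix hfv (fun t => ha (f t)) _
end
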